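/- arXiv:1301.6867 — 4 statements merged into one kernel-verified Lean document; each statement's English description precedes it below -/
import Mathlib

section
/- The Dirac operator is formally symmetric: for all continuously differentiable, compactly supported functions u, v : ℝ³ → ℂ⁴, one has ∫_{ℝ³} ⟨(𝒟u)(x), v(x)⟩ dx = ∫_{ℝ³} ⟨u(x), (𝒟v)(x)⟩ dx, where ⟨·,·⟩ is the standard Hermitian inner product on ℂ⁴. -/
open Matrix MeasureTheory

noncomputable def diracAlpha : Fin 3 → Matrix (Fin 4) (Fin 4) ℂ
  | 0 => !![0, 0, 0, 1; 0, 0, 1, 0; 0, 1, 0, 0; 1, 0, 0, 0]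
  | 1 => !![0, 0, 0, -Complex.I; 0, 0, Complex.I, 0;
            0, -Complex.I, 0, 0; Complex.I, 0, 0, 0]
  | 2 => !![0, 0, 1, 0; 0, 0, 0, -1; 1, 0, 0, 0; 0, -1, 0, 0]

/-- The massless Dirac operator `𝒟u = -i ∑ αₖ ∂ₖ u`. -/
noncomputable def diracOp (u : EuclideanSpace ℝ (Fin 3) → (Fin 4 → ℂ))
    (x : EuclideanSpace ℝ (Fin 3)) : Fin 4 → ℂ :=
  (-Complex.I) • ∑ k : Fin 3,
    (diracAlpha k).mulVec (fderiv ℝ u x (EuclideanSpace.single k 1))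

/-- The standard Hermitian inner product on `ℂ⁴` (conjugate-linear in the first slot). -/
noncomputable def hermInner (a b : Fin 4 → ℂ) : ℂ :=
  ∑ i : Fin 4, (starRingEnd ℂ) (a i) * b i

theorem diracAlpha_isHermitian (k : Fin 3) : (diracAlpha k).IsHermitian := by
  ext i j
  fin_cases k <;> fin_cases i <;> fin_cases j <;> simp [diracAlpha]

theorem hermInner_eq_dotProduct (a b : Fin 4 → ℂ) : hermInner a b = star a ⬝ᵥ b := rfl

/-- The real-bilinear map `(a, b) ↦ ⟨a, -i A b⟩` on `ℂ⁴`. -/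
noncomputable def hermInnerNegIMul (A : Matrix (Fin 4) (Fin 4) ℂ) :
    (Fin 4 → ℂ) →L[ℝ] (Fin 4 → ℂ) →L[ℝ] ℂ :=
  (LinearMap.mk₂ ℝ (fun a b ↦ star a ⬝ᵥ ((-Complex.I) • A *ᵥ b))
    (fun a a' b ↦ by simp only [star_add, add_dotProduct])
    (fun c a b ↦ by simp only [star_smul, star_trivial, smul_dotProduct])
    (fun a b b' ↦ by simp only [mulVec_add, smul_add, dotProduct_add])
    (fun c a b ↦ by
      simp only [mulVec_smul, smul_comm _ c, dotProduct_smul])).toContinuousBilinearMap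

theorem hermInnerNegIMul_apply (A : Matrix (Fin 4) (Fin 4) ℂ) (a b : Fin 4 → ℂ) :
    hermInnerNegIMul A a b = star a ⬝ᵥ ((-Complex.I) • A *ᵥ b) := rfl

theorem hermInner_diracOp_right (u v : EuclideanSpace ℝ (Fin 3) → (Fin 4 → ℂ))
    (x : EuclideanSpace ℝ (Fin 3)) :
    hermInner (u x) (diracOp v x) = ∑ k : Fin 3,
      hermInnerNegIMul (diracAlpha k) (u x) (fderiv ℝ v x (EuclideanSpace.single k 1)) := by
  simp only [hermInner_eq_dotProduct, diracOp, hermInnerNegIMul_apply, Finset.smul_sum,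
    dotProduct_sum]

theorem hermInner_diracOp_left (u v : EuclideanSpace ℝ (Fin 3) → (Fin 4 → ℂ))
    (x : EuclideanSpace ℝ (Fin 3)) :
    hermInner (diracOp u x) (v x) = ∑ k : Fin 3,
      -hermInnerNegIMul (diracAlpha k) (fderiv ℝ u x (EuclideanSpace.single k 1)) (v x) := by
  simp only [hermInner_eq_dotProduct, diracOp, hermInnerNegIMul_apply, Finset.smul_sum,
    star_sum, sum_dotProduct]
  refine Finset.sum_congr rfl fun k _ ↦ ?_
  rw [star_smul, star_mulVec, (diracAlpha_isHermitian k).eq, smul_dotProduct,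
    ← dotProduct_mulVec, dotProduct_smul]
  simp

theorem dirac_formally_symmetric
    (u v : EuclideanSpace ℝ (Fin 3) → (Fin 4 → ℂ))
    (hu : ContDiff ℝ 1 u) (hv : ContDiff ℝ 1 v)
    (hcu : HasCompactSupport u) (hcv : HasCompactSupport v) :
    ∫ x : EuclideanSpace ℝ (Fin 3), hermInner (diracOp u x) (v x) =
      ∫ x : EuclideanSpace ℝ (Fin 3), hermInner (u x) (diracOp v x) := by
  have hu' (k : Fin 3) : Continuous fun x ↦ fderiv ℝ u x (EuclideanSpace.single k 1) :=
    (hu.continuous_fderiv one_ne_zero).clm_apply continuous_const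
  have hv' (k : Fin 3) : Continuous fun x ↦ fderiv ℝ v x (EuclideanSpace.single k 1) :=
    (hv.continuous_fderiv one_ne_zero).clm_apply continuous_const
  have integrable_form {f g : EuclideanSpace ℝ (Fin 3) → (Fin 4 → ℂ)} (k : Fin 3)
      (hf : Continuous f) (hg : Continuous g) (hcg : HasCompactSupport g) :
      Integrable fun x ↦ hermInnerNegIMul (diracAlpha k) (f x) (g x) :=
    (((hermInnerNegIMul (diracAlpha k)).continuous.comp hf).clm_apply
      hg).integrable_of_hasCompactSupport
      (hcg.mono fun x hx h ↦ hx (by simp [h]))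
  have hleft k := integrable_form k (hu' k) hv.continuous hcv
  have hright k := integrable_form k hu.continuous (hv' k) (hcv.fderiv_apply ℝ _)
  simp_rw [hermInner_diracOp_left, hermInner_diracOp_right]
  rw [integral_finsetSum _ fun k _ ↦ (hleft k).fun_neg, integral_finsetSum _ fun k _ ↦ hright k]
  refine Finset.sum_congr rfl fun k _ ↦ ?_
  rw [integral_neg, integral_bilinear_fderiv_right_eq_neg_left_of_integrable (hleft k) (hright k)
    (integrable_form k hu.continuous hv.continuous hcv)
    (fun x _ ↦ hu.differentiable one_ne_zero x) (fun x _ ↦ hv.differentiable one_ne_zero x)]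
end

section
/- Radial endpoint estimate for the truncated radial integral operator: there exists a constant C > 0 such that for every measurable f : (0,∞) → ℂ with ∫_0^∞ s²|f(s)|² ds < ∞, the function u(t,x) = ‖x‖^{−1} ∫_{|‖x‖−t|}^{‖x‖+t} s f(s) ds satisfies ∫_0^∞ ( sup_{x ∈ ℝ³, x ≠ 0} |u(t,x)| )² dt ≤ C ∫_{ℝ³} |f(‖x‖)|² dx. -/
open MeasureTheory ENNReal

/-- The uncentered Hardy–Littlewood maximal function on `ℝ`, normalized by the radius. -/
noncomputable def hardyLittlewoodMax (g : ℝ → ℝ≥0∞) (t : ℝ) : ℝ≥0∞ :=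
  ⨆ p : ℝ × ℝ, (Metric.ball p.1 p.2).indicator
    (fun _ => (∫⁻ s in Metric.ball p.1 p.2, g s) / ENNReal.ofReal p.2) t

lemma measurable_hardyLittlewoodMax (g : ℝ → ℝ≥0∞) : Measurable (hardyLittlewoodMax g) :=
  (lowerSemicontinuous_iSup fun _ =>
    Metric.isOpen_ball.lowerSemicontinuous_indicator zero_le).measurable

/-- The Vitali covering argument behind the weak type `(1, 1)` inequality. -/
lemma mul_volume_iUnion_ball_le (h : ℝ → ℝ≥0∞) {a : ℝ} (ha : 0 < a) :
    ENNReal.ofReal a * volume (⋃ p ∈ {p : ℝ × ℝ | 0 < p.2 ∧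
      ENNReal.ofReal a * ENNReal.ofReal p.2 ≤ ∫⁻ s in Metric.ball p.1 p.2, h s},
        Metric.ball p.1 p.2) ≤ 8 * ∫⁻ s, h s := by
  set T := {p : ℝ × ℝ | 0 < p.2 ∧
      ENNReal.ofReal a * ENNReal.ofReal p.2 ≤ ∫⁻ s in Metric.ball p.1 p.2, h s}
  by_cases hfin : ∫⁻ s, h s = ⊤
  · simp [hfin, ENNReal.mul_top]
  have hbd : ∀ p ∈ T, p.2 ≤ (∫⁻ s, h s).toReal / a := by
    rintro p ⟨-, hp⟩
    rw [le_div_iff₀ ha, mul_comm, ← ENNReal.ofReal_le_iff_le_toReal hfin,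
      ENNReal.ofReal_mul ha.le]
    exact hp.trans (setLIntegral_le_lintegral _ _)
  obtain ⟨u, huT, hdisj, hcov⟩ := Vitali.exists_disjoint_subfamily_covering_enlargement_ball
    T (fun p => p.1) (fun p => p.2) _ hbd 4 (by norm_num)
  have hcount : u.Countable := hdisj.countable_of_isOpen (fun _ _ => Metric.isOpen_ball)
    fun p hp => Metric.nonempty_ball.2 (huT hp).1
  have : Countable u := hcount.to_subtype
  have hsub : (⋃ p ∈ T, Metric.ball p.1 p.2) ⊆ ⋃ p ∈ u, Metric.ball p.1 (4 * p.2) := by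
    refine Set.iUnion₂_subset fun p hp => ?_
    obtain ⟨q, hq, hpq⟩ := hcov p hp
    exact hpq.trans (Set.subset_biUnion_of_mem (u := fun p : ℝ × ℝ => Metric.ball p.1 (4 * p.2)) hq)
  calc ENNReal.ofReal a * volume (⋃ p ∈ T, Metric.ball p.1 p.2)
      ≤ ENNReal.ofReal a * ∑' p : u, volume (Metric.ball p.1.1 (4 * p.1.2)) := by
        gcongr
        exact (measure_mono hsub).trans (measure_biUnion_le _ hcount _)
    _ = 8 * ∑' p : u, ENNReal.ofReal a * ENNReal.ofReal p.1.2 := by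
        rw [← ENNReal.tsum_mul_left, ← ENNReal.tsum_mul_left]
        refine tsum_congr fun p => ?_
        rw [Real.volume_ball, ← mul_assoc, ENNReal.ofReal_mul (by norm_num)]
        norm_num
        ring
    _ ≤ 8 * ∑' p : u, ∫⁻ s in Metric.ball p.1.1 p.1.2, h s := by
        gcongr with p
        exact (huT p.2).2
    _ = 8 * ∫⁻ s in ⋃ p ∈ u, Metric.ball p.1 p.2, h s := by
        rw [lintegral_biUnion hcount (fun _ _ => measurableSet_ball) hdisj]
    _ ≤ 8 * ∫⁻ s, h s := by
        gcongr 8 * ?_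
        exact setLIntegral_le_lintegral _ _

/-- The weak type `(1, 1)` inequality, using only the large values of `g`. -/
lemma mul_volume_lt_hardyLittlewoodMax_le (g : ℝ → ℝ≥0∞) {a : ℝ} (ha : 0 < a) :
    ENNReal.ofReal a * volume {t | ENNReal.ofReal a < hardyLittlewoodMax g t} ≤
      16 * ∫⁻ s, {s | ENNReal.ofReal a < 4 * g s}.indicator g s := by
  set h : ℝ → ℝ≥0∞ := {s | ENNReal.ofReal a < 4 * g s}.indicator g
  have hgh : ∀ s, g s ≤ h s + ENNReal.ofReal (a / 4) := by
    intro s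
    by_cases hs : ENNReal.ofReal a < 4 * g s
    · simp [h, hs]
    · have : 4 * g s ≤ 4 * ENNReal.ofReal (a / 4) := by
        rw [← ENNReal.ofReal_ofNat 4, ← ENNReal.ofReal_mul (by norm_num)]
        simpa [mul_div_cancel₀] using not_lt.1 hs
      exact ((ENNReal.mul_le_mul_iff_right (by norm_num) (by norm_num)).1 this).trans le_add_self
  have hsub : {t | ENNReal.ofReal a < hardyLittlewoodMax g t} ⊆
      ⋃ p ∈ {p : ℝ × ℝ | 0 < p.2 ∧
        ENNReal.ofReal (a / 2) * ENNReal.ofReal p.2 ≤ ∫⁻ s in Metric.ball p.1 p.2, h s},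
          Metric.ball p.1 p.2 := by
    intro t ht
    obtain ⟨p, hp⟩ := lt_iSup_iff.1 (show ENNReal.ofReal a < hardyLittlewoodMax g t from ht)
    by_cases htp : t ∈ Metric.ball p.1 p.2
    · have hr : 0 < p.2 := Metric.pos_of_mem_ball htp
      refine Set.mem_biUnion (x := p) ⟨hr, ?_⟩ htp
      rw [Set.indicator_of_mem htp, ENNReal.lt_div_iff_mul_lt (by simp [hr]) (by simp)] at hp
      have h1 : ∫⁻ s in Metric.ball p.1 p.2, g s ≤
          (∫⁻ s in Metric.ball p.1 p.2, h s) +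
            ENNReal.ofReal (a / 2) * ENNReal.ofReal p.2 := by
        calc ∫⁻ s in Metric.ball p.1 p.2, g s
            ≤ ∫⁻ s in Metric.ball p.1 p.2, (h s + ENNReal.ofReal (a / 4)) :=
              lintegral_mono hgh
          _ = _ := by
            rw [lintegral_add_right _ measurable_const, setLIntegral_const, Real.volume_ball,
              ← ENNReal.ofReal_mul (by positivity), ← ENNReal.ofReal_mul (by positivity)]
            congr 2
            ring
      have h2 : ENNReal.ofReal a * ENNReal.ofReal p.2 =
          ENNReal.ofReal (a / 2) * ENNReal.ofReal p.2 +
            ENNReal.ofReal (a / 2) * ENNReal.ofReal p.2 := by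
        rw [← add_mul, ← ENNReal.ofReal_add (by positivity) (by positivity), add_halves]
      rw [h2] at hp
      exact (ENNReal.add_le_add_iff_right
        (ENNReal.mul_ne_top ENNReal.ofReal_ne_top ENNReal.ofReal_ne_top)).1 (hp.le.trans h1)
    · simp [htp] at hp
  calc ENNReal.ofReal a * volume {t | ENNReal.ofReal a < hardyLittlewoodMax g t}
      = 2 * (ENNReal.ofReal (a / 2) *
          volume {t | ENNReal.ofReal a < hardyLittlewoodMax g t}) := by
        rw [← mul_assoc, ← ENNReal.ofReal_ofNat 2, ← ENNReal.ofReal_mul (by norm_num),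
          mul_div_cancel₀ _ (by norm_num)]
    _ ≤ 2 * (8 * ∫⁻ s, h s) := by
        gcongr 2 * ?_
        exact (mul_le_mul_right (measure_mono hsub) _).trans
          (mul_volume_iUnion_ball_le h (half_pos ha))
    _ = 16 * ∫⁻ s, h s := by rw [← mul_assoc]; norm_num

/-- A lower bound in the layer cake formula for squares. -/
lemma ENNReal.sq_le_four_mul_lintegral (b : ℝ≥0∞) :
    b ^ 2 ≤ 4 * ∫⁻ a in Set.Ioi (0 : ℝ),
      {a : ℝ | ENNReal.ofReal a < b}.indicator ENNReal.ofReal a := by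
  have key : ∀ c d : ℝ, 0 ≤ c → ENNReal.ofReal d ≤ b →
      ENNReal.ofReal c * ENNReal.ofReal (d - c) ≤ ∫⁻ a in Set.Ioi (0 : ℝ),
        {a : ℝ | ENNReal.ofReal a < b}.indicator ENNReal.ofReal a := by
    intro c d hc hd
    calc ENNReal.ofReal c * ENNReal.ofReal (d - c)
        = ∫⁻ a in Set.Ioo c d, ENNReal.ofReal c := by simp
      _ ≤ ∫⁻ a in Set.Ioo c d,
            {a : ℝ | ENNReal.ofReal a < b}.indicator ENNReal.ofReal a := by
          refine setLIntegral_mono' measurableSet_Ioo fun a ha => ?_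
          have hab : ENNReal.ofReal a < b :=
            ((ENNReal.ofReal_lt_ofReal_iff ((hc.trans_lt ha.1).trans ha.2)).2 ha.2).trans_le hd
          rw [Set.indicator_of_mem (show a ∈ {a : ℝ | ENNReal.ofReal a < b} from hab)]
          exact ENNReal.ofReal_le_ofReal ha.1.le
      _ ≤ _ := lintegral_mono_set fun a ha => hc.trans_lt ha.1
  have hfin : ∀ d : ℝ, 0 ≤ d → ENNReal.ofReal d ≤ b → ENNReal.ofReal d ^ 2 ≤
      4 * ∫⁻ a in Set.Ioi (0 : ℝ),
        {a : ℝ | ENNReal.ofReal a < b}.indicator ENNReal.ofReal a := by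
    intro d hd hdb
    refine le_trans (le_of_eq ?_) (mul_le_mul_right (key (d / 2) d (by positivity) hdb) 4)
    rw [← ENNReal.ofReal_mul (by positivity), ← ENNReal.ofReal_pow hd,
      ← ENNReal.ofReal_ofNat 4, ← ENNReal.ofReal_mul (by norm_num)]
    congr 1
    ring
  by_cases hb : b = ⊤
  · subst hb
    rw [ENNReal.top_pow (by norm_num), top_le_iff]
    refine ENNReal.eq_top_of_forall_nnreal_le fun r => ?_
    have h1 := hfin (r + 1) (by positivity) le_top
    refine le_trans ?_ h1
    rw [← ENNReal.ofReal_pow (by positivity), ← ENNReal.ofReal_coe_nnreal]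
    exact ENNReal.ofReal_le_ofReal (by nlinarith [r.coe_nonneg])
  · simpa [ENNReal.ofReal_toReal hb] using hfin b.toReal ENNReal.toReal_nonneg
      (ENNReal.ofReal_toReal hb).le

lemma volume_Ioi_inter_ofReal_lt_le (b : ℝ≥0∞) :
    volume (Set.Ioi (0 : ℝ) ∩ {a : ℝ | ENNReal.ofReal a < b}) ≤ b := by
  by_cases hb : b = ⊤
  · simp [hb]
  calc volume (Set.Ioi (0 : ℝ) ∩ {a : ℝ | ENNReal.ofReal a < b})
      ≤ volume (Set.Ioo 0 b.toReal) := measure_mono fun a ha =>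
        ⟨ha.1, (ENNReal.ofReal_lt_iff_lt_toReal (le_of_lt ha.1) hb).1 ha.2⟩
    _ = b := by simp [ENNReal.ofReal_toReal hb]

/-- The Hardy–Littlewood maximal inequality in `L²(ℝ)`. -/
theorem lintegral_hardyLittlewoodMax_sq_le {g : ℝ → ℝ≥0∞} (hg : Measurable g) :
    ∫⁻ t, hardyLittlewoodMax g t ^ 2 ≤ 256 * ∫⁻ s, g s ^ 2 := by
  have hM := measurable_hardyLittlewoodMax g
  have hlevel {φ : ℝ → ℝ≥0∞} (hφ : Measurable φ) :
      MeasurableSet {p : ℝ × ℝ | ENNReal.ofReal p.1 < φ p.2} :=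
    measurableSet_lt (ENNReal.measurable_ofReal.comp measurable_fst) (hφ.comp measurable_snd)
  have hm1 : Measurable fun p : ℝ × ℝ =>
      {p : ℝ × ℝ | ENNReal.ofReal p.1 < hardyLittlewoodMax g p.2}.indicator
        (fun p => ENNReal.ofReal p.1) p :=
    (ENNReal.measurable_ofReal.comp measurable_fst).indicator (hlevel hM)
  have hm2 : Measurable fun p : ℝ × ℝ =>
      {p : ℝ × ℝ | ENNReal.ofReal p.1 < 4 * g p.2}.indicator (fun p => g p.2) p :=
    (hg.comp measurable_snd).indicator (hlevel (hg.const_mul 4))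
  calc ∫⁻ t, hardyLittlewoodMax g t ^ 2
      ≤ ∫⁻ t, 4 * ∫⁻ a in Set.Ioi (0 : ℝ),
          {p : ℝ × ℝ | ENNReal.ofReal p.1 < hardyLittlewoodMax g p.2}.indicator
            (fun p => ENNReal.ofReal p.1) (a, t) :=
        lintegral_mono fun t => ENNReal.sq_le_four_mul_lintegral _
    _ = 4 * ∫⁻ a in Set.Ioi (0 : ℝ), ∫⁻ t,
          {p : ℝ × ℝ | ENNReal.ofReal p.1 < hardyLittlewoodMax g p.2}.indicator
            (fun p => ENNReal.ofReal p.1) (a, t) := by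
        rw [lintegral_const_mul' _ _ (by norm_num), lintegral_lintegral_swap]
        exact (hm1.comp measurable_swap).aemeasurable
    _ ≤ 4 * ∫⁻ a in Set.Ioi (0 : ℝ), 16 * ∫⁻ s,
          {p : ℝ × ℝ | ENNReal.ofReal p.1 < 4 * g p.2}.indicator (fun p => g p.2) (a, s) := by
        gcongr 4 * ?_
        refine setLIntegral_mono' measurableSet_Ioi fun a ha => ?_
        refine le_trans (le_of_eq ?_) (mul_volume_lt_hardyLittlewoodMax_le g ha)
        exact lintegral_indicator_const
          (s := {t | ENNReal.ofReal a < hardyLittlewoodMax g t})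
          (measurableSet_lt measurable_const hM) (ENNReal.ofReal a)
    _ = 64 * ∫⁻ s, ∫⁻ a in Set.Ioi (0 : ℝ),
          {p : ℝ × ℝ | ENNReal.ofReal p.1 < 4 * g p.2}.indicator (fun p => g p.2) (a, s) := by
        rw [lintegral_const_mul' _ _ (by norm_num), lintegral_lintegral_swap hm2.aemeasurable,
          ← mul_assoc]
        norm_num
    _ ≤ 64 * ∫⁻ s, 4 * g s ^ 2 := by
        gcongr 64 * ?_
        refine lintegral_mono fun s => ?_
        calc ∫⁻ a in Set.Ioi (0 : ℝ),
              {a : ℝ | ENNReal.ofReal a < 4 * g s}.indicator (fun _ => g s) a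
            = g s * volume (Set.Ioi (0 : ℝ) ∩ {a : ℝ | ENNReal.ofReal a < 4 * g s}) := by
              have hms : MeasurableSet {a : ℝ | ENNReal.ofReal a < 4 * g s} :=
                measurableSet_lt ENNReal.measurable_ofReal measurable_const
              rw [lintegral_indicator_const hms, Measure.restrict_apply hms, Set.inter_comm]
          _ ≤ g s * (4 * g s) := by
              gcongr
              exact volume_Ioi_inter_ofReal_lt_le _
          _ = 4 * g s ^ 2 := by ring
    _ = 256 * ∫⁻ s, g s ^ 2 := by
        rw [lintegral_const_mul' _ _ (by norm_num), ← mul_assoc]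
        norm_num

lemma setLIntegral_ball_le_mul_hardyLittlewoodMax (g : ℝ → ℝ≥0∞) (t : ℝ) {r : ℝ} (hr : 0 < r) :
    ∫⁻ s in Metric.ball t r, g s ≤ ENNReal.ofReal r * hardyLittlewoodMax g t := by
  have h := le_iSup (fun p : ℝ × ℝ => (Metric.ball p.1 p.2).indicator
    (fun _ => (∫⁻ s in Metric.ball p.1 p.2, g s) / ENNReal.ofReal p.2) t) (t, r)
  rw [Set.indicator_of_mem (Metric.mem_ball_self hr)] at h
  rw [mul_comm]
  exact (ENNReal.div_le_iff (by simp [hr]) (by simp)).1 h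

/-- Integration in polar coordinates on `ℝ³`, for the squared norm of a radial function. -/
lemma lintegral_sq_enorm_comp_norm {f : ℝ → ℂ} (hf : Measurable f)
    (hfin : ∫⁻ s in Set.Ioi (0 : ℝ), ENNReal.ofReal (s ^ 2) * (‖f s‖₊ : ℝ≥0∞) ^ 2 < ⊤) :
    ∫⁻ x : EuclideanSpace ℝ (Fin 3), (‖f ‖x‖‖₊ : ℝ≥0∞) ^ 2 =
      ENNReal.ofReal (3 * volume.real (Metric.ball (0 : EuclideanSpace ℝ (Fin 3)) 1)) *
        ∫⁻ s in Set.Ioi (0 : ℝ), ENNReal.ofReal (s ^ 2) * (‖f s‖₊ : ℝ≥0∞) ^ 2 := by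
  have hconv : ∀ z : ℂ, (‖z‖₊ : ℝ≥0∞) ^ 2 = ENNReal.ofReal (‖z‖ ^ 2) := fun z => by
    rw [ENNReal.ofReal_pow (norm_nonneg z), ofReal_norm, enorm_eq_nnnorm]
  have hconv' : ∀ s : ℝ, ENNReal.ofReal (s ^ 2) * (‖f s‖₊ : ℝ≥0∞) ^ 2 =
      ENNReal.ofReal (s ^ 2 * ‖f s‖ ^ 2) := fun s => by
    rw [hconv, ENNReal.ofReal_mul (sq_nonneg s)]
  simp only [hconv'] at hfin ⊢
  simp only [hconv]
  have hint : IntegrableOn (fun s : ℝ => s ^ 2 * ‖f s‖ ^ 2) (Set.Ioi 0) :=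
    (lintegral_ofReal_ne_top_iff_integrable (by fun_prop)
      (ae_of_all _ fun s => by positivity)).1 hfin.ne
  have hint' : Integrable (fun x : EuclideanSpace ℝ (Fin 3) => ‖f ‖x‖‖ ^ 2) :=
    (integrable_fun_norm_addHaar volume (f := fun s => ‖f s‖ ^ 2)).2 (by simpa using hint)
  have hpolar := integral_fun_norm_addHaar (volume : Measure (EuclideanSpace ℝ (Fin 3)))
    (fun s => ‖f s‖ ^ 2)
  rw [← ofReal_integral_eq_lintegral_ofReal hint' (ae_of_all _ fun x => by positivity),
    ← ofReal_integral_eq_lintegral_ofReal hint (ae_of_all _ fun x => by positivity),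
    ← ENNReal.ofReal_mul (by positivity), hpolar]
  simp [mul_assoc]

theorem radial_endpoint_estimate :
    ∃ C : ℝ, 0 < C ∧ ∀ f : ℝ → ℂ, Measurable f →
      (∫⁻ s in Set.Ioi (0 : ℝ), ENNReal.ofReal (s ^ 2) * (‖f s‖₊ : ℝ≥0∞) ^ 2) < ⊤ →
      (∫⁻ t in Set.Ioi (0 : ℝ),
          (⨆ (x : EuclideanSpace ℝ (Fin 3)) (_ : x ≠ 0),
            (‖(‖x‖⁻¹ : ℝ) •
                ∫ s in Set.Ioc |‖x‖ - t| (‖x‖ + t), (s : ℂ) * f s‖₊ : ℝ≥0∞)) ^ 2) ≤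
        ENNReal.ofReal C *
          ∫⁻ x : EuclideanSpace ℝ (Fin 3), (‖f ‖x‖‖₊ : ℝ≥0∞) ^ 2 := by
  set κ : ℝ := 3 * volume.real (Metric.ball (0 : EuclideanSpace ℝ (Fin 3)) 1) with hκdef
  have hκ : 0 < κ := mul_pos (by norm_num) (ENNReal.toReal_pos
    (Metric.measure_ball_pos volume _ one_pos).ne' measure_ball_lt_top.ne)
  refine ⟨1024 / κ, by positivity, fun f hf hfin => ?_⟩
  set g : ℝ → ℝ≥0∞ := (Set.Ioi (0 : ℝ)).indicator fun s => ‖(s : ℂ) * f s‖ₑ with hgdef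
  have hg : Measurable g := Measurable.indicator (by fun_prop) measurableSet_Ioi
  have hpt : ∀ t : ℝ, (⨆ (x : EuclideanSpace ℝ (Fin 3)) (_ : x ≠ 0),
      (‖(‖x‖⁻¹ : ℝ) • ∫ s in Set.Ioc |‖x‖ - t| (‖x‖ + t), (s : ℂ) * f s‖₊ : ℝ≥0∞)) ≤
        2 * hardyLittlewoodMax g t := by
    refine fun t => iSup₂_le fun x hx => ?_
    have hr : 0 < ‖x‖ := norm_pos_iff.2 hx
    have hball : Set.Ioc |‖x‖ - t| (‖x‖ + t) ⊆ Metric.ball t (2 * ‖x‖) := by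
      intro s hs
      have := neg_abs_le (‖x‖ - t)
      rw [Metric.mem_ball, Real.dist_eq, abs_lt]
      constructor <;> linarith [hs.1, hs.2]
    have hI : ‖∫ s in Set.Ioc |‖x‖ - t| (‖x‖ + t), (s : ℂ) * f s‖ₑ ≤
        ENNReal.ofReal (2 * ‖x‖) * hardyLittlewoodMax g t := by
      calc ‖∫ s in Set.Ioc |‖x‖ - t| (‖x‖ + t), (s : ℂ) * f s‖ₑ
          ≤ ∫⁻ s in Set.Ioc |‖x‖ - t| (‖x‖ + t), ‖(s : ℂ) * f s‖ₑ :=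
            enorm_integral_le_lintegral_enorm _
        _ = ∫⁻ s in Set.Ioc |‖x‖ - t| (‖x‖ + t), g s :=
            setLIntegral_congr_fun measurableSet_Ioc fun s hs =>
              (Set.indicator_of_mem (show s ∈ Set.Ioi (0 : ℝ) from
                (abs_nonneg _).trans_lt hs.1) fun s : ℝ => ‖(s : ℂ) * f s‖ₑ).symm
        _ ≤ ∫⁻ s in Metric.ball t (2 * ‖x‖), g s := lintegral_mono_set hball
        _ ≤ _ := setLIntegral_ball_le_mul_hardyLittlewoodMax g t (by positivity)
    rw [← enorm_eq_nnnorm, enorm_smul, Real.enorm_eq_ofReal (by positivity)]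
    refine (mul_le_mul_right hI _).trans (le_of_eq ?_)
    rw [← mul_assoc, ← ENNReal.ofReal_mul (by positivity), mul_comm 2 ‖x‖,
      inv_mul_cancel_left₀ hr.ne', ENNReal.ofReal_ofNat]
  have hgsq : ∫⁻ s, g s ^ 2 =
      ∫⁻ s in Set.Ioi (0 : ℝ), ENNReal.ofReal (s ^ 2) * (‖f s‖₊ : ℝ≥0∞) ^ 2 := by
    rw [← lintegral_indicator measurableSet_Ioi]
    refine lintegral_congr fun s => ?_
    by_cases hs : s ∈ Set.Ioi (0 : ℝ)
    · rw [hgdef, Set.indicator_of_mem hs, Set.indicator_of_mem hs, enorm_mul, mul_pow,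
        ← ofReal_norm, Complex.norm_real, ← ENNReal.ofReal_pow (norm_nonneg _),
        Real.norm_eq_abs, sq_abs, enorm_eq_nnnorm]
    · simp [hgdef, Set.indicator_of_notMem hs]
  rw [lintegral_sq_enorm_comp_norm hf hfin, ← hgsq, ← mul_assoc,
    ← ENNReal.ofReal_mul (by positivity), ← hκdef, div_mul_cancel₀ _ hκ.ne',
    ENNReal.ofReal_ofNat]
  calc _ ≤ ∫⁻ t in Set.Ioi (0 : ℝ), (2 * hardyLittlewoodMax g t) ^ 2 :=
        lintegral_mono fun t => pow_le_pow_left₀ zero_le (hpt t) 2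
    _ ≤ ∫⁻ t, (2 * hardyLittlewoodMax g t) ^ 2 := setLIntegral_le_lintegral _ _
    _ = 4 * ∫⁻ t, hardyLittlewoodMax g t ^ 2 := by
        simp_rw [mul_pow]
        rw [lintegral_const_mul' _ _ (by norm_num)]
        norm_num
    _ ≤ 4 * (256 * ∫⁻ s, g s ^ 2) := by
        gcongr
        exact lintegral_hardyLittlewoodMax_sq_le hg
    _ = 1024 * ∫⁻ s, g s ^ 2 := by rw [← mul_assoc]; norm_num
end

section
/- The partial-wave cubic nonlinearity has no angular dependence: for all a, b ∈ ℂ and every ω ∈ ℝ³ with ‖ω‖ = 1, setting u = aΦ⁺(ω) + bΦ⁻(ω) ∈ ℂ⁴, one has ⟨βu, u⟩ = (|a|² − |b|²)/(4π); in particular this value is independent of ω ∈ S². -/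
open Matrix

noncomputable def diracBeta : Matrix (Fin 4) (Fin 4) ℂ :=
  Matrix.diagonal ![1, 1, -1, -1]

/-- The partial-wave basis function `Φ⁺(ω) = (i/(2√π)) (ω₃, ω₁+iω₂, 0, 0)`. -/
noncomputable def PhiPlus (ω : EuclideanSpace ℝ (Fin 3)) : Fin 4 → ℂ :=
  (Complex.I / (2 * Real.sqrt Real.pi)) •
    ![(ω 2 : ℂ), (ω 0 : ℂ) + Complex.I * (ω 1 : ℂ), 0, 0]

/-- The partial-wave basis function `Φ⁻(ω) = (1/(2√π)) (0, 0, 1, 0)`. -/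
noncomputable def PhiMinus (_ω : EuclideanSpace ℝ (Fin 3)) : Fin 4 → ℂ :=
  (1 / (2 * Real.sqrt Real.pi) : ℂ) • ![0, 0, 1, 0]

theorem partial_wave_cubic_no_angular_dependence
    (a b : ℂ) (ω : EuclideanSpace ℝ (Fin 3)) (hω : ‖ω‖ = 1) :
    hermInner (diracBeta.mulVec (a • PhiPlus ω + b • PhiMinus ω))
        (a • PhiPlus ω + b • PhiMinus ω) =
      (((‖a‖ ^ 2 - ‖b‖ ^ 2) / (4 * Real.pi) : ℝ) : ℂ) := by
  have hsphere : (ω 0 : ℂ) ^ 2 + (ω 1 : ℂ) ^ 2 + (ω 2 : ℂ) ^ 2 = 1 := by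
    have h := EuclideanSpace.real_norm_sq_eq ω
    rw [hω, Fin.sum_univ_three] at h
    exact_mod_cast (h.symm.trans (one_pow 2))
  have hpi : ((Real.sqrt Real.pi : ℝ) : ℂ) ^ 2 = (Real.pi : ℂ) := by
    exact_mod_cast Real.sq_sqrt Real.pi_pos.le
  have hsqrt : ((Real.sqrt Real.pi : ℝ) : ℂ) ≠ 0 := by
    exact_mod_cast (Real.sqrt_pos.mpr Real.pi_pos).ne'
  push_cast
  rw [← Complex.conj_mul' a, ← Complex.conj_mul' b, ← hpi]
  simp only [hermInner, diracBeta, PhiPlus, PhiMinus, mulVec_diagonal, Fin.sum_univ_four]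
  simp [Complex.conj_ofNat]
  field_simp
  linear_combination 4 * (starRingEnd ℂ a * a) * (hsphere
    + ((ω 1 : ℂ) ^ 2 * (Complex.I ^ 2 - 1) - (ω 0 : ℂ) ^ 2 - (ω 2 : ℂ) ^ 2) * Complex.I_sq)
end

section
/- Invariance of the j = 1/2 partial-wave subspace under the cubic nonlinearity: let u⁺, u⁻ : (0,∞) → ℂ and define u : ℝ³ \ {0} → ℂ⁴ by u(x) = u⁺(‖x‖)Φ⁺(x/‖x‖) + u⁻(‖x‖)Φ⁻(x/‖x‖). Then the cubic nonlinearity P₃(u)(x) = ⟨βu(x), u(x)⟩ · u(x) again has the same partial-wave form: P₃(u)(x) = c⁺(‖x‖)Φ⁺(x/‖x‖) + c⁻(‖x‖)Φ⁻(x/‖x‖), with radial coefficients c^±(r) = (4π)^{−1}(|u⁺(r)|² − |u⁻(r)|²) u^±(r). -/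
open Matrix

theorem hermInner_diracBeta_mulVec_self (v : Fin 4 → ℂ) :
    hermInner (diracBeta.mulVec v) v =
      ((‖v 0‖ ^ 2 + ‖v 1‖ ^ 2 - ‖v 2‖ ^ 2 - ‖v 3‖ ^ 2 : ℝ) : ℂ) := by
  simp only [hermInner, diracBeta, mulVec_diagonal, Fin.sum_univ_four, map_mul]
  push_cast
  simp only [← Complex.conj_mul']
  simp
  ring

theorem hermInner_diracBeta_partialWave (a b : ℂ) {ω : EuclideanSpace ℝ (Fin 3)} (hω : ‖ω‖ = 1) :
    hermInner (diracBeta.mulVec (a • PhiPlus ω + b • PhiMinus ω)) (a • PhiPlus ω + b • PhiMinus ω) =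
      (((4 * Real.pi)⁻¹ : ℝ) : ℂ) * ((‖a‖ ^ 2 - ‖b‖ ^ 2 : ℝ) : ℂ) := by
  have hsum : ω 0 ^ 2 + ω 1 ^ 2 + ω 2 ^ 2 = 1 := by
    simpa [hω, Fin.sum_univ_three] using (EuclideanSpace.real_norm_sq_eq ω).symm
  have hsqrt : √Real.pi ^ 2 = Real.pi := Real.sq_sqrt Real.pi_pos.le
  have hnorm : ‖(ω 0 : ℂ) + Complex.I * (ω 1 : ℂ)‖ ^ 2 = ω 0 ^ 2 + ω 1 ^ 2 := by
    rw [Complex.sq_norm, Complex.normSq_apply]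
    simp
    ring
  rw [hermInner_diracBeta_mulVec_self, ← Complex.ofReal_mul, Complex.ofReal_inj]
  simp only [PhiPlus, PhiMinus, Pi.add_apply, Pi.smul_apply, smul_eq_mul]
  simp [mul_pow, hnorm, hsqrt]
  field_simp
  linear_combination 4 * ‖a‖ ^ 2 * hsum

theorem partial_wave_invariant_under_cubic_nonlinearity
    (uPlus uMinus : ℝ → ℂ)
    (u : EuclideanSpace ℝ (Fin 3) → (Fin 4 → ℂ))
    (hu : ∀ x : EuclideanSpace ℝ (Fin 3), x ≠ 0 →
      u x = uPlus ‖x‖ • PhiPlus (‖x‖⁻¹ • x) + uMinus ‖x‖ • PhiMinus (‖x‖⁻¹ • x)) :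
    ∀ x : EuclideanSpace ℝ (Fin 3), x ≠ 0 →
      hermInner (diracBeta.mulVec (u x)) (u x) • u x =
        ((((4 * Real.pi)⁻¹ : ℝ) : ℂ) *
            (((‖uPlus ‖x‖‖ ^ 2 - ‖uMinus ‖x‖‖ ^ 2 : ℝ) : ℂ)) * uPlus ‖x‖) •
          PhiPlus (‖x‖⁻¹ • x) +
        ((((4 * Real.pi)⁻¹ : ℝ) : ℂ) *
            (((‖uPlus ‖x‖‖ ^ 2 - ‖uMinus ‖x‖‖ ^ 2 : ℝ) : ℂ)) * uMinus ‖x‖) •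
          PhiMinus (‖x‖⁻¹ • x) := by
  intro x hx
  have hunit : ‖‖x‖⁻¹ • x‖ = 1 := by
    simp [norm_smul, hx]
  rw [hu x hx, hermInner_diracBeta_partialWave _ _ hunit, smul_add, smul_smul, smul_smul]
end
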